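/- arXiv:1702.01627 — 2 statements merged into one kernel-verified Lean document; each statement's English description precedes it below -/
import Mathlib

section
/- For every positive integer n, the number r_4(n) of ordered quadruples (x,y,z,w) ∈ ℤ⁴ with x² + y² + z² + w² = n equals 8 times the sum of those positive divisors d of n with 4 ∤ d (Jacobi's four-square theorem). -/
/-- `r₄ n` is the number of ordered quadruples `(x,y,z,w) ∈ ℤ⁴` with `x²+y²+z²+w² = n`. -/
noncomputable def r4 (n : ℕ) : ℕ :=
  Set.ncard {v : ℤ × ℤ × ℤ × ℤ | v.1 ^ 2 + v.2.1 ^ 2 + v.2.2.1 ^ 2 + v.2.2.2 ^ 2 = (n : ℤ)}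

namespace JacobiFourSquare

open Finset ZMod

/-- The pairs of integers whose squares sum to `n`. -/
noncomputable def twoSquares (n : ℕ) : Finset (ℤ × ℤ) :=
  (Icc (-(n : ℤ)) n ×ˢ Icc (-(n : ℤ)) n).filter fun v => v.1 ^ 2 + v.2 ^ 2 = n

theorem mem_Icc_of_sq_le {x : ℤ} {n : ℕ} (h : x ^ 2 ≤ n) : x ∈ Icc (-(n : ℤ)) n := by
  rw [mem_Icc]
  constructor <;> nlinarith [Int.le_self_sq x, Int.le_self_sq (-x)]

theorem mem_twoSquares {n : ℕ} {v : ℤ × ℤ} :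
    v ∈ twoSquares n ↔ v.1 ^ 2 + v.2 ^ 2 = n := by
  simp only [twoSquares, mem_filter, mem_product, and_iff_right_iff_imp]
  exact fun h => ⟨mem_Icc_of_sq_le (by nlinarith [sq_nonneg v.2]),
    mem_Icc_of_sq_le (by nlinarith [sq_nonneg v.1])⟩

/-- Multiplication by the Gaussian integer `a + b i`. -/
def gaussMul (a b : ℤ) (v : ℤ × ℤ) : ℤ × ℤ := (a * v.1 - b * v.2, a * v.2 + b * v.1)

theorem gaussMul_injective {a b : ℤ} (h : a ^ 2 + b ^ 2 ≠ 0) :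
    Function.Injective (gaussMul a b) := by
  rintro ⟨x, y⟩ ⟨z, w⟩ hv
  simp only [gaussMul, Prod.mk.injEq] at hv ⊢
  constructor <;> apply mul_left_cancel₀ h
  · linear_combination a * hv.1 + b * hv.2
  · linear_combination a * hv.2 - b * hv.1

theorem filter_dvd_twoSquares {p n : ℕ} (hp : p.Prime) {a b : ℤ} (hab : a ^ 2 + b ^ 2 = p) :
    (twoSquares (p * n)).filter (fun v => (p : ℤ) ∣ a * v.1 + b * v.2) =
      (twoSquares n).image (gaussMul a b) := by
  have hpz : Prime (p : ℤ) := Nat.prime_iff_prime_int.mp hp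
  ext ⟨x, y⟩
  simp only [mem_filter, mem_twoSquares, mem_image, Prod.exists, gaussMul, Prod.mk.injEq]
  push_cast
  constructor
  · rintro ⟨h, u, hu⟩
    obtain ⟨v, hv⟩ : (p : ℤ) ∣ a * y - b * x := by
      apply hpz.dvd_of_dvd_pow (n := 2)
      refine ⟨p * n - p * u ^ 2, ?_⟩
      linear_combination (x ^ 2 + y ^ 2) * hab + p * h - (a * x + b * y + p * u) * hu
    refine ⟨u, v, ?_, ?_, ?_⟩
    · apply mul_left_cancel₀ (pow_ne_zero 2 hpz.ne_zero)
      linear_combination (x ^ 2 + y ^ 2) * hab + p * h - (a * x + b * y + p * u) * hu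
        - (a * y - b * x + p * v) * hv
    · apply mul_left_cancel₀ hpz.ne_zero
      linear_combination x * hab - a * hu + b * hv
    · apply mul_left_cancel₀ hpz.ne_zero
      linear_combination y * hab - a * hv - b * hu
  · rintro ⟨u, v, h, rfl, rfl⟩
    exact ⟨by linear_combination (u ^ 2 + v ^ 2) * hab + p * h,
      u, by linear_combination u * hab⟩

theorem card_filter_dvd_twoSquares {p n : ℕ} (hp : p.Prime) {a b : ℤ}
    (hab : a ^ 2 + b ^ 2 = p) :
    #((twoSquares (p * n)).filter fun v => (p : ℤ) ∣ a * v.1 + b * v.2) = #(twoSquares n) := by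
  rw [filter_dvd_twoSquares hp hab, card_image_of_injective]
  exact gaussMul_injective (by rw [hab]; exact_mod_cast hp.ne_zero)

theorem card_filter_dvd_dvd_twoSquares {p n : ℕ} (hp : p.Prime) :
    #((twoSquares (p * n)).filter fun v => (p : ℤ) ∣ v.1 ∧ (p : ℤ) ∣ v.2) =
      if p ∣ n then #(twoSquares (n / p)) else 0 := by
  have hp0 : (p : ℤ) ≠ 0 := by exact_mod_cast hp.ne_zero
  split_ifs with h
  · obtain ⟨k, rfl⟩ := h
    rw [Nat.mul_div_cancel_left _ hp.pos,
      ← card_image_of_injective (twoSquares k) (f := fun v => ((p : ℤ) * v.1, (p : ℤ) * v.2))]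
    · congr 1
      ext ⟨x, y⟩
      simp only [mem_filter, mem_twoSquares, mem_image, Prod.exists, Prod.mk.injEq]
      push_cast
      constructor
      · rintro ⟨h, ⟨u, rfl⟩, v, rfl⟩
        refine ⟨u, v, ?_, rfl, rfl⟩
        apply mul_left_cancel₀ (pow_ne_zero 2 hp0)
        linear_combination h
      · rintro ⟨u, v, h, rfl, rfl⟩
        exact ⟨by linear_combination p ^ 2 * h, dvd_mul_right _ _, dvd_mul_right _ _⟩
    · rintro ⟨x, y⟩ ⟨z, w⟩ h
      simpa [hp.ne_zero] using h
  · rw [card_eq_zero, filter_eq_empty_iff]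
    rintro ⟨x, y⟩ hv ⟨⟨u, hu⟩, v, hw⟩
    rw [mem_twoSquares] at hv
    simp only at hv hu hw
    subst hu hw
    apply h
    rw [← Int.natCast_dvd_natCast]
    refine ⟨u ^ 2 + v ^ 2, ?_⟩
    apply mul_left_cancel₀ hp0
    push_cast at hv
    linear_combination -hv

theorem card_twoSquares_prime_mul_of_mod_four_eq_one {p n : ℕ} (hp : p.Prime)
    (hp4 : p % 4 = 1) :
    #(twoSquares (p * n)) + (if p ∣ n then #(twoSquares (n / p)) else 0) =
      2 * #(twoSquares n) := by
  have hpz : Prime (p : ℤ) := Nat.prime_iff_prime_int.mp hp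
  obtain ⟨a, b, hab⟩ := haveI := Fact.mk hp; Nat.Prime.sq_add_sq (p := p) (by omega)
  have hab : (a : ℤ) ^ 2 + (b : ℤ) ^ 2 = p := by exact_mod_cast hab
  have hab' : (a : ℤ) ^ 2 + (-b : ℤ) ^ 2 = p := by linear_combination hab
  have key : ∀ {c d x : ℤ}, c ^ 2 + d ^ 2 = p → (p : ℤ) ∣ 2 * (c * x) → (p : ℤ) ∣ x := by
    intro c d x hcd h
    rcases hpz.dvd_or_dvd h with h | h
    · have := Int.le_of_dvd (by norm_num) h
      have := hp.two_le
      omega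
    refine (hpz.dvd_or_dvd h).resolve_left fun hc => ?_
    have hd : (p : ℤ) ∣ d := by
      apply hpz.dvd_of_dvd_pow (n := 2)
      rw [show d ^ 2 = p - c * c by linear_combination hcd]
      exact dvd_sub dvd_rfl (hc.mul_left _)
    obtain ⟨u, rfl⟩ := hc
    obtain ⟨v, rfl⟩ := hd
    exact hpz.not_isUnit (isUnit_of_dvd_one ⟨u ^ 2 + v ^ 2, mul_left_cancel₀ hpz.ne_zero
      (by linear_combination -hcd)⟩)
  have h₁ := card_filter_dvd_twoSquares (n := n) hp hab
  have h₂ := card_filter_dvd_twoSquares (n := n) hp hab'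
  rw [two_mul]
  nth_rewrite 1 [← h₁]
  rw [← h₂, ← card_union_add_card_inter, ← filter_or, ← filter_and,
    ← card_filter_dvd_dvd_twoSquares hp]
  congr 2
  · symm
    rw [filter_eq_self]
    rintro ⟨x, y⟩ hv
    rw [mem_twoSquares] at hv
    apply hpz.dvd_or_dvd
    refine ⟨a ^ 2 * n - y ^ 2, ?_⟩
    push_cast at hv
    simp only at hv ⊢
    linear_combination (a : ℤ) ^ 2 * hv - y ^ 2 * hab
  · apply filter_congr
    rintro ⟨x, y⟩ -
    simp only
    constructor
    · rintro ⟨hx, hy⟩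
      exact ⟨dvd_add (hx.mul_left _) (hy.mul_left _), dvd_add (hx.mul_left _) (hy.mul_left _)⟩
    · rintro ⟨h, h'⟩
      refine ⟨key hab ?_, key ((add_comm _ _).trans hab) ?_⟩
      · have := dvd_add h h'
        ring_nf at this ⊢
        exact this
      · have := dvd_sub h h'
        ring_nf at this ⊢
        exact this

theorem card_twoSquares_prime_mul_of_mod_four_eq_three {p n : ℕ} (hp : p.Prime)
    (hp4 : p % 4 = 3) :
    #(twoSquares (p * n)) = if p ∣ n then #(twoSquares (n / p)) else 0 := by
  have := Fact.mk hp
  have key : ∀ {x y : ℤ}, x ^ 2 + y ^ 2 = p * n → (p : ℤ) ∣ x := by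
    intro x y h
    rw [← ZMod.intCast_zmod_eq_zero_iff_dvd]
    by_contra hx
    have h' : (x : ZMod p) ^ 2 + (y : ZMod p) ^ 2 = 0 := by
      have := congrArg (Int.cast : ℤ → ZMod p) h
      simpa using this
    refine ZMod.exists_sq_eq_neg_one_iff.mp ⟨(y : ZMod p) / (x : ZMod p), ?_⟩ hp4
    field_simp
    linear_combination -h'
  rw [← card_filter_dvd_dvd_twoSquares hp, filter_true_of_mem]
  intro v hv
  rw [mem_twoSquares] at hv
  push_cast at hv
  exact ⟨key hv, key ((add_comm _ _).trans hv)⟩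

theorem card_twoSquares_prime_mul {p n : ℕ} (hp : p.Prime) (hp2 : p ≠ 2) :
    (#(twoSquares (p * n)) : ℤ) = (1 + χ₄ p) * #(twoSquares n) -
      χ₄ p * if p ∣ n then (#(twoSquares (n / p)) : ℤ) else 0 := by
  rcases Nat.odd_mod_four_iff.mp (hp.mod_two_eq_one_iff_ne_two.mpr hp2) with h | h
  · rw [χ₄_nat_one_mod_four h]
    have := card_twoSquares_prime_mul_of_mod_four_eq_one (n := n) hp h
    push_cast [← @Nat.cast_inj ℤ] at this
    linear_combination this
  · rw [χ₄_nat_three_mod_four h, card_twoSquares_prime_mul_of_mod_four_eq_three hp h]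
    push_cast
    ring

theorem sum_divisors_χ₄_prime_mul {p n : ℕ} (hp : p.Prime) (hn : n ≠ 0) :
    ∑ d ∈ (p * n).divisors, χ₄ d = (1 + χ₄ p) * ∑ d ∈ n.divisors, χ₄ d -
      χ₄ p * if p ∣ n then ∑ d ∈ (n / p).divisors, χ₄ d else 0 := by
  have hinj : Function.Injective (p * ·) := fun a b h => Nat.eq_of_mul_eq_mul_left hp.pos h
  have hmul : ∀ s : Finset ℕ, ∑ d ∈ s.image (p * ·), χ₄ d = χ₄ p * ∑ d ∈ s, χ₄ d := by
    intro s
    rw [sum_image hinj.injOn, mul_sum]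
    simp only [Nat.cast_mul, map_mul]
  have hunion : (p * n).divisors = n.divisors ∪ n.divisors.image (p * ·) := by
    ext d
    simp only [Nat.mem_divisors, mem_union, mem_image]
    constructor
    · rintro ⟨h, -⟩
      by_cases hd : p ∣ d
      · obtain ⟨e, rfl⟩ := hd
        exact Or.inr ⟨e, ⟨Nat.dvd_of_mul_dvd_mul_left hp.pos h, hn⟩, rfl⟩
      · exact Or.inl ⟨((hp.coprime_iff_not_dvd.mpr hd).symm).dvd_of_dvd_mul_left h, hn⟩
    · rintro (⟨h, -⟩ | ⟨e, ⟨h, -⟩, rfl⟩)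
      · exact ⟨h.mul_left _, mul_ne_zero hp.ne_zero hn⟩
      · exact ⟨Nat.mul_dvd_mul_left _ h, mul_ne_zero hp.ne_zero hn⟩
  have hinter : ∑ d ∈ n.divisors ∩ n.divisors.image (p * ·), χ₄ d =
      χ₄ p * if p ∣ n then ∑ d ∈ (n / p).divisors, χ₄ d else 0 := by
    split_ifs with h
    · rw [← hmul]
      congr 1
      obtain ⟨k, rfl⟩ := h
      rw [Nat.mul_div_cancel_left _ hp.pos]
      ext d
      simp only [Nat.mem_divisors, mem_inter, mem_image]
      constructor
      · rintro ⟨⟨h, -⟩, e, -, rfl⟩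
        exact ⟨e, ⟨Nat.dvd_of_mul_dvd_mul_left hp.pos h, right_ne_zero_of_mul hn⟩, rfl⟩
      · rintro ⟨e, ⟨h, -⟩, rfl⟩
        exact ⟨⟨Nat.mul_dvd_mul_left _ h, hn⟩, e, ⟨h.mul_left _, hn⟩, rfl⟩
    · rw [mul_zero]
      apply sum_eq_zero
      simp only [Nat.mem_divisors, mem_inter, mem_image]
      rintro d ⟨⟨hd, -⟩, e, -, rfl⟩
      exact absurd (dvd_of_mul_right_dvd hd) h
  have := sum_union_inter (s₁ := n.divisors) (s₂ := n.divisors.image (p * ·))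
    (f := fun d : ℕ => χ₄ d)
  rw [hmul, hinter, ← hunion] at this
  linear_combination this

/-- Jacobi's two-square theorem for odd numbers. -/
theorem card_twoSquares_of_odd {n : ℕ} (hn : Odd n) :
    (#(twoSquares n) : ℤ) = 4 * ∑ d ∈ n.divisors, χ₄ d := by
  induction n using Nat.strong_induction_on with
  | _ n ih =>
    rcases eq_or_ne n 1 with rfl | hn1
    · decide
    have hp := Nat.minFac_prime hn1
    obtain ⟨k, hk⟩ := Nat.minFac_dvd n
    generalize n.minFac = p at hp hk
    subst hk
    obtain ⟨hpo, hko⟩ := Nat.odd_mul.mp hn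
    have hk0 : 0 < k := hko.pos
    have hp2 := hp.two_le
    rw [card_twoSquares_prime_mul hp (by rintro h; rw [h] at hpo; exact absurd hpo (by decide)),
      sum_divisors_χ₄_prime_mul hp hk0.ne', ih k (by nlinarith) hko]
    split_ifs with h
    · obtain ⟨l, hl⟩ := h
      have hlo : Odd l := (Nat.odd_mul.mp (hl ▸ hko)).2
      have := hlo.pos
      rw [hl, Nat.mul_div_cancel_left _ hp.pos, ih l (by rw [hl]; nlinarith) hlo]
      ring
    · ring

/-- The `((d, d'), (e, e'))` with `d * d' + e * e' = 2 * m` and `d * d'` odd. -/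
def oddQuads (m : ℕ) : Finset ((ℕ × ℕ) × (ℕ × ℕ)) :=
  ((antidiagonal (2 * m)).filter fun ab => Odd ab.1).biUnion fun ab =>
    ab.1.divisorsAntidiagonal ×ˢ ab.2.divisorsAntidiagonal

theorem mem_oddQuads {m d d' e e' : ℕ} :
    ((d, d'), (e, e')) ∈ oddQuads m ↔
      d * d' + e * e' = 2 * m ∧ Odd d ∧ Odd d' ∧ Odd e ∧ Odd e' := by
  simp only [oddQuads, mem_biUnion, mem_filter, HasAntidiagonal.mem_antidiagonal, mem_product,
    Nat.mem_divisorsAntidiagonal, Prod.exists]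
  constructor
  · rintro ⟨a, b, ⟨h, ha⟩, ⟨rfl, -⟩, rfl, -⟩
    have hb : Odd (e * e') := by
      rw [Nat.odd_iff] at ha ⊢
      omega
    exact ⟨h, (Nat.odd_mul.mp ha).1, (Nat.odd_mul.mp ha).2, (Nat.odd_mul.mp hb).1,
      (Nat.odd_mul.mp hb).2⟩
  · rintro ⟨h, hd, hd', he, he'⟩
    exact ⟨_, _, ⟨h, hd.mul hd'⟩, ⟨rfl, (hd.mul hd').pos.ne'⟩, rfl, (he.mul he').pos.ne'⟩

theorem sum_oddQuads (m : ℕ) :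
    ∑ q ∈ oddQuads m, χ₄ q.1.1 * χ₄ q.2.1 =
      ∑ ab ∈ (antidiagonal (2 * m)).filter (fun ab => Odd ab.1),
        (∑ d ∈ ab.1.divisors, χ₄ d) * ∑ e ∈ ab.2.divisors, χ₄ e := by
  rw [oddQuads, sum_biUnion]
  · refine sum_congr rfl fun ab _ => ?_
    rw [← Nat.sum_divisorsAntidiagonal (fun d _ => χ₄ d),
      ← Nat.sum_divisorsAntidiagonal (fun d _ => χ₄ d), sum_mul_sum, sum_product]
  · rintro ⟨a, b⟩ - ⟨a', b'⟩ - hne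
    rw [Function.onFun, disjoint_left]
    rintro ⟨⟨d, d'⟩, e, e'⟩ h h'
    simp only [mem_product, Nat.mem_divisorsAntidiagonal] at h h'
    exact hne (by rw [← h.1.1, ← h.2.1, h'.1.1, h'.2.1])

theorem χ₄_mul_χ₄_eq {d e : ℕ} (hd : Odd d) (he : Odd e) :
    χ₄ d * χ₄ e = if d % 4 = e % 4 then 1 else -1 := by
  rcases Nat.odd_mod_four_iff.mp (Nat.odd_iff.mp hd) with h | h <;>
  rcases Nat.odd_mod_four_iff.mp (Nat.odd_iff.mp he) with h' | h' <;>
  rw [χ₄_nat_mod_four d, χ₄_nat_mod_four e, h, h'] <;>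
  decide

theorem card_filter_eq_oddQuads {m : ℕ} (hm : Odd m) :
    #((oddQuads m).filter fun q => q.1.1 = q.2.1) = ∑ k ∈ m.divisors, k := by
  trans #(m.divisorsAntidiagonal.sigma fun p => range p.2)
  · refine card_nbij' (fun q => ⟨(q.1.1, (q.1.2 + q.2.2) / 2), q.1.2 / 2⟩)
      (fun p => ((p.1.1, 2 * p.2 + 1), (p.1.1, 2 * p.1.2 - (2 * p.2 + 1)))) ?_ ?_ ?_ ?_
    · rintro ⟨⟨d, d'⟩, e, e'⟩ h
      simp only [coe_filter, Set.mem_ofPred_eq, mem_oddQuads] at h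
      obtain ⟨⟨h, hd, ⟨x, rfl⟩, -, ⟨y, rfl⟩⟩, rfl⟩ := h
      simp only [coe_sigma, Set.mem_sigma_iff, mem_coe, Nat.mem_divisorsAntidiagonal, mem_range]
      rw [show (2 * x + 1 + (2 * y + 1)) / 2 = x + y + 1 by omega]
      exact ⟨⟨by linarith, hm.pos.ne'⟩, by omega⟩
    · rintro ⟨⟨d, k⟩, i⟩ h
      simp only [coe_sigma, Set.mem_sigma_iff, mem_coe, Nat.mem_divisorsAntidiagonal,
        mem_range] at h
      obtain ⟨⟨rfl, -⟩, hi⟩ := h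
      have hd := (Nat.odd_mul.mp hm).1
      simp only [coe_filter, Set.mem_ofPred_eq, mem_oddQuads]
      refine ⟨⟨?_, hd, odd_two_mul_add_one i, hd, ?_⟩, trivial⟩
      · rw [← mul_add, Nat.add_sub_cancel' (by omega)]
        ring
      · rw [Nat.odd_iff]
        omega
    · rintro ⟨⟨d, d'⟩, e, e'⟩ h
      simp only [coe_filter, Set.mem_ofPred_eq, mem_oddQuads] at h
      obtain ⟨⟨h, hd, ⟨x, rfl⟩, -, ⟨y, rfl⟩⟩, rfl⟩ := h
      simp only [Prod.mk.injEq, true_and]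
      omega
    · rintro ⟨⟨d, k⟩, i⟩ h
      simp only [coe_sigma, Set.mem_sigma_iff, mem_coe, Nat.mem_divisorsAntidiagonal,
        mem_range] at h
      have h₁ : (2 * i + 1 + (2 * k - (2 * i + 1))) / 2 = k := by omega
      have h₂ : (2 * i + 1) / 2 = i := by omega
      simp only [h₁, h₂]
  · simp only [card_sigma, card_range]
    exact Nat.sum_divisorsAntidiagonal' (fun _ k => k)

/-- Dirichlet's involution on the `((d, d'), (e, e'))` with `e < d`. -/
def dirichletSwap (q : (ℕ × ℕ) × (ℕ × ℕ)) : (ℕ × ℕ) × (ℕ × ℕ) :=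
  let s := q.1.1 - q.2.1
  let t := q.1.2 + q.2.2
  let f := q.1.2 + q.2.1 / s * t
  ((f + t, q.2.1 % s), (f, s - q.2.1 % s))

theorem dirichletSwap_mem {m : ℕ} {q : (ℕ × ℕ) × (ℕ × ℕ)}
    (hq : q ∈ (oddQuads m).filter fun q => q.2.1 < q.1.1) :
    dirichletSwap q ∈ (oddQuads m).filter fun q => q.2.1 < q.1.1 := by
  obtain ⟨⟨d, d'⟩, e, e'⟩ := q
  simp only [dirichletSwap, mem_filter, mem_oddQuads] at hq ⊢
  obtain ⟨⟨h, hd, hd', he, he'⟩, hlt⟩ := hq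
  obtain ⟨S, rfl, hS⟩ : ∃ S, d = e + 2 * S ∧ 0 < S := by
    rw [Nat.odd_iff] at hd he
    exact ⟨(d - e) / 2, by omega⟩
  rw [Nat.add_sub_cancel_left]
  have hdiv := Nat.mod_add_div e (2 * S)
  have hmod := Nat.mod_lt e (show 2 * S > 0 by omega)
  generalize e % (2 * S) = r at hdiv hmod
  generalize e / (2 * S) = k at hdiv hmod
  obtain ⟨u, hu⟩ := Nat.exists_eq_add_of_le hmod.le
  rw [show 2 * S - r = u by omega]
  have hr : Odd r := by
    rw [← hdiv, mul_assoc, Nat.odd_iff] at he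
    rw [Nat.odd_iff]
    omega
  have ht : Even (d' + e') := hd'.add_odd he'
  have hf : Odd (d' + k * (d' + e')) := hd'.add_even (ht.mul_left k)
  refine ⟨⟨?_, hf.add_even ht, hr, hf, ?_⟩, by have := hd'.pos; omega⟩
  · rw [← h, ← hdiv, hu]
    ring
  · rw [Nat.odd_iff] at hr ⊢
    omega

theorem dirichletSwap_dirichletSwap {d d' e e' : ℕ} (hd' : 0 < d') (he' : 0 < e')
    (hlt : e < d) : dirichletSwap (dirichletSwap ((d, d'), (e, e'))) = ((d, d'), (e, e')) := by
  have hs : 0 < d - e := by omega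
  have hmod := Nat.mod_lt e hs
  have hdiv := Nat.mod_add_div e (d - e)
  simp only [dirichletSwap, Nat.add_sub_cancel_left, Nat.add_sub_cancel' hmod.le]
  have h₁ : (d' + e / (d - e) * (d' + e')) / (d' + e') = e / (d - e) := by
    rw [Nat.add_mul_div_right _ _ (by omega), Nat.div_eq_of_lt (by omega), zero_add]
  have h₂ : (d' + e / (d - e) * (d' + e')) % (d' + e') = d' := by
    rw [Nat.add_mul_mod_self_right, Nat.mod_eq_of_lt (by omega)]
  rw [h₁, h₂, mul_comm (e / (d - e)), hdiv, Nat.add_sub_cancel' hlt.le, Nat.add_sub_cancel_left]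

theorem sum_filter_lt_oddQuads {m : ℕ} (hm : Odd m) :
    ∑ q ∈ (oddQuads m).filter (fun q => q.2.1 < q.1.1), χ₄ q.1.1 * χ₄ q.2.1 = 0 := by
  have key : ∀ q ∈ (oddQuads m).filter fun q => q.2.1 < q.1.1,
      χ₄ q.1.1 * χ₄ q.2.1 + χ₄ (dirichletSwap q).1.1 * χ₄ (dirichletSwap q).2.1 = 0 := by
    rintro ⟨⟨d, d'⟩, e, e'⟩ hq
    have hq' := (mem_filter.mp (dirichletSwap_mem hq)).1
    obtain ⟨h, hd, hd', he, he'⟩ := mem_oddQuads.mp (mem_filter.mp hq).1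
    simp only [dirichletSwap] at hq' ⊢
    obtain ⟨-, h₁, -, h₂, -⟩ := mem_oddQuads.mp hq'
    rw [χ₄_mul_χ₄_eq hd he, χ₄_mul_χ₄_eq h₁ h₂]
    clear h₁ h₂ hq hq'
    generalize d' + e / (d - e) * (d' + e') = f
    have h4 : (d % 4 * (d' % 4) + e % 4 * (e' % 4)) % 4 = 2 := by
      rw [Nat.odd_iff] at hm
      rw [Nat.add_mod, ← Nat.mul_mod, ← Nat.mul_mod, ← Nat.add_mod, h]
      omega
    have hiff : d % 4 = e % 4 ↔ ¬ (f + (d' + e')) % 4 = f % 4 := by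
      rcases Nat.odd_mod_four_iff.mp (Nat.odd_iff.mp hd) with h₁ | h₁ <;>
      rcases Nat.odd_mod_four_iff.mp (Nat.odd_iff.mp hd') with h₂ | h₂ <;>
      rcases Nat.odd_mod_four_iff.mp (Nat.odd_iff.mp he) with h₃ | h₃ <;>
      rcases Nat.odd_mod_four_iff.mp (Nat.odd_iff.mp he') with h₄ | h₄ <;>
      rw [h₁, h₂, h₃, h₄] at h4 <;> omega
    split_ifs <;> first | rfl | tauto
  refine sum_involution (fun q _ => dirichletSwap q) key ?_ (fun q hq => dirichletSwap_mem hq) ?_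
  · intro q hq hne heq
    have := key q hq
    rw [heq] at this
    exact hne (by omega)
  · rintro ⟨⟨d, d'⟩, e, e'⟩ hq
    simp only [mem_filter, mem_oddQuads] at hq
    exact dirichletSwap_dirichletSwap hq.1.2.2.1.pos hq.1.2.2.2.2.pos hq.2

theorem sum_oddQuads_of_odd {m : ℕ} (hm : Odd m) :
    ∑ q ∈ oddQuads m, χ₄ q.1.1 * χ₄ q.2.1 = ∑ k ∈ m.divisors, (k : ℤ) := by
  have hgt : ∑ q ∈ (oddQuads m).filter (fun q => q.1.1 < q.2.1), χ₄ q.1.1 * χ₄ q.2.1 = 0 := by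
    rw [← sum_filter_lt_oddQuads hm]
    refine sum_nbij' Prod.swap Prod.swap ?_ ?_ (fun _ _ => rfl) (fun _ _ => rfl)
      (fun _ _ => mul_comm _ _)
    all_goals
      rintro ⟨⟨d, d'⟩, e, e'⟩ h
      simp only [mem_filter, mem_oddQuads, Prod.swap] at h ⊢
      exact ⟨⟨by linarith, by tauto⟩, h.2⟩
  have hdiag : ∑ q ∈ (oddQuads m).filter (fun q => q.1.1 = q.2.1), χ₄ q.1.1 * χ₄ q.2.1 =
      ∑ k ∈ m.divisors, (k : ℤ) := by
    rw [← Nat.cast_sum, ← card_filter_eq_oddQuads hm, card_eq_sum_ones, Nat.cast_sum]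
    refine sum_congr rfl ?_
    rintro ⟨⟨d, d'⟩, e, e'⟩ h
    simp only [mem_filter, mem_oddQuads] at h
    rw [χ₄_mul_χ₄_eq h.1.2.1 h.1.2.2.2.1, if_pos (by rw [h.2]), Nat.cast_one]
  rw [← sum_filter_add_sum_filter_not _ (fun q => q.1.1 = q.2.1), hdiag,
    ← sum_filter_add_sum_filter_not (filter _ _) (fun q => q.2.1 < q.1.1), filter_filter,
    filter_filter, filter_congr (q := fun q => q.2.1 < q.1.1) fun q _ => by omega,
    sum_filter_lt_oddQuads hm, filter_congr (q := fun q => q.1.1 < q.2.1) fun q _ => by omega,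
    hgt, add_zero, add_zero]

/-- The quadruples of integers whose squares sum to `n`. -/
noncomputable def fourSquares (n : ℕ) : Finset (ℤ × ℤ × ℤ × ℤ) :=
  (Icc (-(n : ℤ)) n ×ˢ Icc (-(n : ℤ)) n ×ˢ Icc (-(n : ℤ)) n ×ˢ Icc (-(n : ℤ)) n).filter
    fun v => v.1 ^ 2 + v.2.1 ^ 2 + v.2.2.1 ^ 2 + v.2.2.2 ^ 2 = n

theorem mem_fourSquares {n : ℕ} {v : ℤ × ℤ × ℤ × ℤ} :
    v ∈ fourSquares n ↔ v.1 ^ 2 + v.2.1 ^ 2 + v.2.2.1 ^ 2 + v.2.2.2 ^ 2 = n := by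
  simp only [fourSquares, mem_filter, mem_product, and_iff_right_iff_imp]
  intro h
  refine ⟨?_, ?_, ?_, ?_⟩ <;> apply mem_Icc_of_sq_le <;>
  linarith [sq_nonneg v.1, sq_nonneg v.2.1, sq_nonneg v.2.2.1, sq_nonneg v.2.2.2]

theorem r4_eq_card_fourSquares (n : ℕ) : r4 n = #(fourSquares n) := by
  rw [r4, ← Set.ncard_coe_finset]
  congr 1
  ext v
  simp [mem_fourSquares]

theorem even_add_iff_of_mem_fourSquares {n : ℕ} {x y z w : ℤ}
    (h : (x, y, z, w) ∈ fourSquares (2 * n)) : Even (x + y) ↔ Even (z + w) := by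
  rw [mem_fourSquares] at h
  have : Even (x ^ 2 + y ^ 2 + z ^ 2 + w ^ 2) := ⟨n, by push_cast at h; linarith⟩
  simp only [Int.even_add, Int.even_pow' two_ne_zero] at this ⊢
  tauto

theorem sq_emod_four (x : ℤ) : x ^ 2 % 4 = x % 2 := by
  rcases Int.even_or_odd' x with ⟨k, rfl | rfl⟩ <;> ring_nf <;> omega

theorem card_filter_even_fourSquares (n : ℕ) :
    #((fourSquares (2 * n)).filter fun v => Even (v.1 + v.2.1)) = #(fourSquares n) := by
  refine card_nbij'
    (fun v => ((v.1 + v.2.1) / 2, (v.1 - v.2.1) / 2, (v.2.2.1 + v.2.2.2) / 2,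
      (v.2.2.1 - v.2.2.2) / 2))
    (fun v => (v.1 + v.2.1, v.1 - v.2.1, v.2.2.1 + v.2.2.2, v.2.2.1 - v.2.2.2)) ?_ ?_ ?_ ?_
  · rintro ⟨x, y, z, w⟩ hv
    obtain ⟨h, hxy⟩ := mem_filter.mp hv
    obtain ⟨b, hb⟩ := (even_add_iff_of_mem_fourSquares h).mp hxy
    obtain ⟨a, ha⟩ := hxy
    rw [mem_fourSquares] at h
    simp only [mem_coe, mem_fourSquares] at h ha hb ⊢
    rw [show (x + y) / 2 = a by omega, show (x - y) / 2 = a - y by omega,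
      show (z + w) / 2 = b by omega, show (z - w) / 2 = b - w by omega]
    obtain rfl : x = 2 * a - y := by omega
    obtain rfl : z = 2 * b - w := by omega
    push_cast at h
    linarith
  · rintro ⟨x, y, z, w⟩ hv
    simp only [coe_filter, Set.mem_ofPred_eq, mem_coe, mem_fourSquares] at hv ⊢
    push_cast
    exact ⟨by linarith, x, by ring⟩
  · rintro ⟨x, y, z, w⟩ hv
    obtain ⟨h, hxy⟩ := mem_filter.mp hv
    obtain ⟨b, hb⟩ := (even_add_iff_of_mem_fourSquares h).mp hxy
    obtain ⟨a, ha⟩ := hxy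
    simp only [Prod.mk.injEq] at ha ⊢
    omega
  · rintro ⟨x, y, z, w⟩ -
    simp only [Prod.mk.injEq]
    omega

theorem card_filter_not_even_fourSquares {m : ℕ} (hm : Odd m) :
    #((fourSquares (2 * m)).filter fun v => ¬ Even (v.1 + v.2.1)) = 2 * #(fourSquares m) := by
  have hz : #((fourSquares (2 * m)).filter fun v => Even (v.1 + v.2.2.1)) =
      #(fourSquares m) := by
    rw [← card_filter_even_fourSquares]
    refine card_nbij' (fun v => (v.1, v.2.2.1, v.2.1, v.2.2.2))
      (fun v => (v.1, v.2.2.1, v.2.1, v.2.2.2)) ?_ ?_ (fun _ _ => rfl) (fun _ _ => rfl)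
    all_goals
      rintro ⟨x, y, z, w⟩ hv
      simp only [coe_filter, Set.mem_ofPred_eq, mem_fourSquares] at hv ⊢
      exact ⟨by linarith, hv.2⟩
  have hw : #((fourSquares (2 * m)).filter fun v => Even (v.1 + v.2.2.2)) =
      #(fourSquares m) := by
    rw [← card_filter_even_fourSquares]
    refine card_nbij' (fun v => (v.1, v.2.2.2, v.2.2.1, v.2.1))
      (fun v => (v.1, v.2.2.2, v.2.2.1, v.2.1)) ?_ ?_ (fun _ _ => rfl) (fun _ _ => rfl)
    all_goals
      rintro ⟨x, y, z, w⟩ hv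
      simp only [coe_filter, Set.mem_ofPred_eq, mem_fourSquares] at hv ⊢
      exact ⟨by linarith, hv.2⟩
  have hmod : ∀ v ∈ fourSquares (2 * m), ¬ Even (v.1 + v.2.1) ↔
      (Even (v.1 + v.2.2.1) ∨ Even (v.1 + v.2.2.2)) := by
    rintro ⟨x, y, z, w⟩ hv
    have := sq_emod_four x
    have := sq_emod_four y
    have := sq_emod_four z
    have := sq_emod_four w
    rw [mem_fourSquares] at hv
    rw [Nat.odd_iff] at hm
    simp only [Int.even_iff] at hv ⊢
    omega
  rw [filter_congr hmod, filter_or, card_union_of_disjoint, hz, hw, two_mul]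
  rw [disjoint_filter]
  rintro ⟨x, y, z, w⟩ hv h h'
  have h₁ := hmod _ hv
  have h₂ := even_add_iff_of_mem_fourSquares hv
  simp only [Int.even_add] at h h' h₁ h₂
  tauto

theorem card_filter_not_even_fourSquares_eq_sum (m : ℕ) :
    #((fourSquares (2 * m)).filter fun v => ¬ Even (v.1 + v.2.1)) =
      ∑ ab ∈ (antidiagonal (2 * m)).filter (fun ab => Odd ab.1),
        #(twoSquares ab.1) * #(twoSquares ab.2) := by
  rw [card_eq_sum_card_fiberwise (t := (antidiagonal (2 * m)).filter fun ab => Odd ab.1)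
    (f := fun v => ((v.1 ^ 2 + v.2.1 ^ 2).toNat, (v.2.2.1 ^ 2 + v.2.2.2 ^ 2).toNat))]
  · refine sum_congr rfl ?_
    rintro ⟨a, b⟩ hab
    rw [mem_filter, HasAntidiagonal.mem_antidiagonal] at hab
    rw [← card_product]
    refine card_nbij' (fun v => ((v.1, v.2.1), (v.2.2.1, v.2.2.2)))
      (fun v => (v.1.1, v.1.2, v.2.1, v.2.2)) ?_ ?_ (fun _ _ => rfl) (fun _ _ => rfl)
    · rintro ⟨x, y, z, w⟩ hv
      simp only [coe_filter, Set.mem_ofPred_eq, coe_product, Set.mem_prod, mem_coe,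
        mem_twoSquares, Prod.mk.injEq] at hv ⊢
      have := add_nonneg (sq_nonneg x) (sq_nonneg y)
      have := add_nonneg (sq_nonneg z) (sq_nonneg w)
      omega
    · rintro ⟨⟨x, y⟩, z, w⟩ hv
      simp only [coe_filter, Set.mem_ofPred_eq, coe_product, Set.mem_prod, mem_coe, mem_filter,
        mem_twoSquares, mem_fourSquares, Prod.mk.injEq] at hv ⊢
      refine ⟨⟨by omega, ?_⟩, by omega, by omega⟩
      have h : ¬ Even (x ^ 2 + y ^ 2) := by
        rw [hv.1, Int.even_coe_nat, Nat.not_even_iff_odd]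
        exact hab.2
      simpa only [Int.even_add, Int.even_pow' two_ne_zero] using h
  · rintro ⟨x, y, z, w⟩ hv
    simp only [coe_filter, Set.mem_ofPred_eq, mem_fourSquares,
      HasAntidiagonal.mem_antidiagonal] at hv ⊢
    have h₁ := add_nonneg (sq_nonneg x) (sq_nonneg y)
    have h₂ := add_nonneg (sq_nonneg z) (sq_nonneg w)
    refine ⟨by omega, ?_⟩
    rw [← Nat.not_even_iff_odd, ← Int.even_coe_nat, Int.toNat_of_nonneg h₁]
    simpa only [Int.even_add, Int.even_pow' two_ne_zero] using hv.2

theorem r4_of_odd {m : ℕ} (hm : Odd m) : r4 m = 8 * ∑ d ∈ m.divisors, d := by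
  have h : ((2 * #(fourSquares m) : ℕ) : ℤ) = 16 * ∑ d ∈ m.divisors, (d : ℤ) := by
    rw [← card_filter_not_even_fourSquares hm, card_filter_not_even_fourSquares_eq_sum,
      ← sum_oddQuads_of_odd hm, sum_oddQuads, mul_sum, Nat.cast_sum]
    refine sum_congr rfl ?_
    rintro ⟨a, b⟩ hab
    rw [mem_filter, HasAntidiagonal.mem_antidiagonal] at hab
    obtain ⟨hab, ha⟩ := hab
    have hb : Odd b := by
      rw [Nat.odd_iff] at ha ⊢
      omega
    rw [Nat.cast_mul, card_twoSquares_of_odd ha, card_twoSquares_of_odd hb]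
    ring
  rw [r4_eq_card_fourSquares]
  zify
  push_cast at h
  linarith

theorem r4_two_mul_of_odd {m : ℕ} (hm : Odd m) : r4 (2 * m) = 3 * r4 m := by
  rw [r4_eq_card_fourSquares, r4_eq_card_fourSquares,
    ← card_filter_add_card_filter_not (s := fourSquares (2 * m)) fun v => Even (v.1 + v.2.1),
    card_filter_even_fourSquares, card_filter_not_even_fourSquares hm]
  ring

theorem r4_two_mul_of_even {n : ℕ} (hn : Even n) : r4 (2 * n) = r4 n := by
  rw [r4_eq_card_fourSquares, r4_eq_card_fourSquares, ← card_filter_even_fourSquares n,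
    filter_true_of_mem]
  rintro ⟨x, y, z, w⟩ hv
  have := sq_emod_four x
  have := sq_emod_four y
  have := sq_emod_four z
  have := sq_emod_four w
  rw [mem_fourSquares] at hv
  rw [Nat.even_iff] at hn
  simp only [Int.even_iff] at hv ⊢
  omega

theorem filter_not_four_dvd_divisors_two_mul {n : ℕ} (hn : Even n) :
    (2 * n).divisors.filter (fun d => ¬ 4 ∣ d) = n.divisors.filter (fun d => ¬ 4 ∣ d) := by
  obtain ⟨k, rfl⟩ := hn.exists_two_nsmul
  ext d
  simp only [mem_filter, Nat.mem_divisors, smul_eq_mul]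
  refine and_congr_left fun hd => ⟨?_, fun h => ⟨h.1.mul_left _, by simpa using h.2⟩⟩
  rintro ⟨h, h0⟩
  refine ⟨?_, by simpa using h0⟩
  rcases Nat.even_or_odd' d with ⟨e, rfl | rfl⟩
  · have he : Nat.Coprime e 2 := by
      rw [Nat.coprime_two_right, Nat.odd_iff]
      omega
    exact Nat.mul_dvd_mul_left _ (he.dvd_of_dvd_mul_left (Nat.dvd_of_mul_dvd_mul_left two_pos h))
  · have he : Nat.Coprime (2 * e + 1) 2 := Nat.coprime_two_right.mpr ⟨e, rfl⟩
    exact he.dvd_of_dvd_mul_left h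

theorem filter_not_four_dvd_divisors {n : ℕ} (hn : ¬ 4 ∣ n) :
    n.divisors.filter (fun d => ¬ 4 ∣ d) = n.divisors :=
  filter_true_of_mem fun _ hd h => hn (h.trans (Nat.dvd_of_mem_divisors hd))

end JacobiFourSquare

/-- Jacobi's four-square theorem: `r₄(n) = 8 Σ_{d ∣ n, 4 ∤ d} d` for every positive `n`. -/
theorem jacobi_four_square (n : ℕ) (hn : 0 < n) :
    r4 n = 8 * ∑ d ∈ n.divisors.filter (fun d => ¬ (4 ∣ d)), d := by
  induction n using Nat.strong_induction_on with
  | _ n ih =>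
    rcases Nat.even_or_odd' n with ⟨m, rfl | rfl⟩
    · rcases Nat.even_or_odd m with hm | hm
      · rw [JacobiFourSquare.r4_two_mul_of_even hm, ih m (by omega) (by omega),
          JacobiFourSquare.filter_not_four_dvd_divisors_two_mul hm]
      · rw [JacobiFourSquare.r4_two_mul_of_odd hm, JacobiFourSquare.r4_of_odd hm,
          JacobiFourSquare.filter_not_four_dvd_divisors (by rw [Nat.odd_iff] at hm; omega),
          Nat.Coprime.sum_divisors_mul (Nat.coprime_two_left.mpr hm),
          Nat.Prime.sum_divisors Nat.prime_two]
        ring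
    · rw [JacobiFourSquare.r4_of_odd ⟨m, rfl⟩,
        JacobiFourSquare.filter_not_four_dvd_divisors (by omega)]
end

section
/- For every positive integer n, the number r_2(n) of ordered pairs (x,y) ∈ ℤ² with x² + y² = n equals 4·(d_1(n) − d_3(n)), where d_k(n) is the number of positive divisors of n congruent to k modulo 4. -/
/-- `r₂ n` is the number of ordered pairs `(x,y) ∈ ℤ²` with `x² + y² = n`. -/
noncomputable def r2 (n : ℕ) : ℕ :=
  Set.ncard {v : ℤ × ℤ | v.1 ^ 2 + v.2 ^ 2 = (n : ℤ)}

/-- Two integer-valued functions on the positive integers which agree at `1` and satisfy the same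
second order recurrence along multiplication by every prime are equal. -/
theorem eq_of_prime_recurrence {F G : ℕ → ℤ} (c : ℕ → ℤ) (h1 : F 1 = G 1)
    (hF : ∀ p m, p.Prime → 0 < m →
      F (p * m) + c p * (if p ∣ m then F (m / p) else 0) = (1 + c p) * F m)
    (hG : ∀ p m, p.Prime → 0 < m →
      G (p * m) + c p * (if p ∣ m then G (m / p) else 0) = (1 + c p) * G m)
    (n : ℕ) (hn : 0 < n) : F n = G n := by
  induction n using Nat.strong_induction_on with
  | _ n ih =>
    rcases eq_or_ne n 1 with rfl | hn1
    · exact h1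
    obtain ⟨p, hp, m, rfl⟩ := Nat.exists_prime_and_dvd hn1
    have hm : 0 < m := Nat.pos_of_mul_pos_left hn
    have hlt : m < p * m := by nlinarith [hp.two_le]
    have hquot : (if p ∣ m then F (m / p) else 0) = if p ∣ m then G (m / p) else 0 := by
      split_ifs with hd
      · exact ih _ ((Nat.div_le_self m p).trans_lt hlt)
          (Nat.div_pos (Nat.le_of_dvd hm hd) hp.pos)
      · rfl
    have hF' := hF p m hp hm
    rw [hquot, ih m hlt hm] at hF'
    linarith [hG p m hp hm]

/-- The divisor sum of a multiplicative function satisfies the prime recurrence. -/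
theorem sum_divisors_prime_mul {f : ℕ → ℤ} (hf : ∀ a b, f (a * b) = f a * f b)
    {p m : ℕ} (hp : p.Prime) (hm : 0 < m) :
    (∑ d ∈ (p * m).divisors, f d) +
        f p * (if p ∣ m then ∑ d ∈ (m / p).divisors, f d else 0) =
      (1 + f p) * ∑ d ∈ m.divisors, f d := by
  classical
  have hinj : Function.Injective (p * · : ℕ → ℕ) := fun a b h =>
    Nat.eq_of_mul_eq_mul_left hp.pos h
  have hsum : ∀ s : Finset ℕ, ∑ d ∈ s.image (p * ·), f d = f p * ∑ d ∈ s, f d := fun s => by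
    rw [Finset.sum_image hinj.injOn, Finset.mul_sum]
    exact Finset.sum_congr rfl fun d _ => hf p d
  have hunion : (p * m).divisors = m.divisors ∪ m.divisors.image (p * ·) := by
    ext d
    simp only [Nat.mem_divisors, Finset.mem_union, Finset.mem_image]
    constructor
    · rintro ⟨hd, -⟩
      by_cases hpd : p ∣ d
      · obtain ⟨e, rfl⟩ := hpd
        exact Or.inr ⟨e, ⟨Nat.dvd_of_mul_dvd_mul_left hp.pos hd, hm.ne'⟩, rfl⟩
      · exact Or.inl ⟨(((Nat.Prime.coprime_iff_not_dvd hp).2 hpd).symm).dvd_of_dvd_mul_left hd,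
          hm.ne'⟩
    · rintro (⟨hd, -⟩ | ⟨e, ⟨he, -⟩, rfl⟩)
      · exact ⟨hd.mul_left p, (Nat.mul_pos hp.pos hm).ne'⟩
      · exact ⟨Nat.mul_dvd_mul_left p he, (Nat.mul_pos hp.pos hm).ne'⟩
  have hinter : m.divisors ∩ m.divisors.image (p * ·) =
      (if p ∣ m then (m / p).divisors else ∅).image (p * ·) := by
    ext d
    simp only [Nat.mem_divisors, Finset.mem_inter, Finset.mem_image]
    split_ifs with hpm
    · obtain ⟨k, rfl⟩ := hpm
      have hk : k ≠ 0 := by rintro rfl; simp at hm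
      simp only [Nat.mul_div_cancel_left k hp.pos, Nat.mem_divisors]
      constructor
      · rintro ⟨⟨hd, -⟩, e, -, rfl⟩
        exact ⟨e, ⟨Nat.dvd_of_mul_dvd_mul_left hp.pos hd, hk⟩, rfl⟩
      · rintro ⟨e, ⟨he, -⟩, rfl⟩
        exact ⟨⟨Nat.mul_dvd_mul_left p he, hm.ne'⟩, e, ⟨he.mul_left p, hm.ne'⟩, rfl⟩
    · simp only [Finset.notMem_empty, false_and, exists_false, iff_false]
      rintro ⟨⟨hd, -⟩, e, -, rfl⟩
      exact hpm ((Dvd.intro e rfl).trans hd)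
  have hcard := Finset.sum_union_inter (f := f) (s₁ := m.divisors)
    (s₂ := m.divisors.image (p * ·))
  rw [← hunion, hinter, hsum, hsum] at hcard
  have hif : ∑ d ∈ (if p ∣ m then (m / p).divisors else ∅), f d =
      if p ∣ m then ∑ d ∈ (m / p).divisors, f d else 0 := by
    split_ifs <;> simp
  rw [hif] at hcard
  linarith

/-- The divisor sum of the nontrivial character mod `4` counts divisors in the two odd classes. -/
theorem sum_divisors_chi_four (n : ℕ) :
    ∑ d ∈ n.divisors, ZMod.χ₄ (d : ZMod 4) =
      ((n.divisors.filter (fun d => d % 4 = 1)).card : ℤ)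
        - ((n.divisors.filter (fun d => d % 4 = 3)).card : ℤ) := by
  rw [Finset.card_filter, Finset.card_filter]
  push_cast
  rw [← Finset.sum_sub_distrib]
  refine Finset.sum_congr rfl fun d _ => ?_
  rw [ZMod.χ₄_nat_eq_if_mod_four]
  split_ifs <;> first | rfl | omega

/-- Only finitely many integer pairs have a given sum of squares. -/
theorem finite_sq_add_sq_eq (n : ℤ) : {v : ℤ × ℤ | v.1 ^ 2 + v.2 ^ 2 = n}.Finite := by
  refine ((Set.finite_Icc (-n) n).prod (Set.finite_Icc (-n) n)).subset ?_
  rintro ⟨x, y⟩ h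
  simp only [Set.mem_ofPred_eq, Set.mem_prod, Set.mem_Icc] at h ⊢
  have hx := Int.natAbs_le_self_sq x
  have hy := Int.natAbs_le_self_sq y
  have := sq_nonneg x
  have := sq_nonneg y
  omega

theorem r2_one : r2 1 = 4 := by
  have h : {v : ℤ × ℤ | v.1 ^ 2 + v.2 ^ 2 = ((1 : ℕ) : ℤ)} =
      (({(1, 0), (-1, 0), (0, 1), (0, -1)} : Finset (ℤ × ℤ)) : Set (ℤ × ℤ)) := by
    ext ⟨x, y⟩
    simp only [Set.mem_ofPred_eq, Finset.coe_insert, Finset.coe_singleton, Set.mem_insert_iff,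
      Set.mem_singleton_iff, Prod.mk.injEq, Nat.cast_one]
    constructor
    · intro h
      have hx1 : x ≤ 1 := by nlinarith [sq_nonneg y]
      have hx2 : -1 ≤ x := by nlinarith [sq_nonneg y]
      have hy1 : y ≤ 1 := by nlinarith [sq_nonneg x]
      have hy2 : -1 ≤ y := by nlinarith [sq_nonneg x]
      interval_cases x <;> interval_cases y <;> simp_all
    · rintro (⟨rfl, rfl⟩ | ⟨rfl, rfl⟩ | ⟨rfl, rfl⟩ | ⟨rfl, rfl⟩) <;> norm_num
  rw [r2, h, Set.ncard_coe_finset]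
  decide

/-- The pairs of norm `p * m` with both coordinates divisible by `p` are counted by `r2 (m / p)`. -/
theorem ncard_image_mul_prime {p m : ℕ} (hp : p.Prime) :
    ((fun v : ℤ × ℤ => ((p : ℤ) * v.1, (p : ℤ) * v.2)) ''
        {v : ℤ × ℤ | (p : ℤ) * (v.1 ^ 2 + v.2 ^ 2) = m}).ncard =
      if p ∣ m then r2 (m / p) else 0 := by
  rw [Set.ncard_image_of_injective]
  · split_ifs with hd
    · obtain ⟨k, rfl⟩ := hd
      rw [Nat.mul_div_cancel_left k hp.pos, r2]
      congr 1
      ext v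
      simp [hp.ne_zero]
    · convert Set.ncard_empty (ℤ × ℤ)
      exact Set.eq_empty_of_forall_notMem fun v h =>
        hd (Int.natCast_dvd_natCast.1 ⟨_, h.symm⟩)
  · rintro ⟨x, y⟩ ⟨z, w⟩ h
    simpa [hp.ne_zero] using h

/-- Multiplication by the Gaussian integer `a + b i`. -/
def gaussianMul (a b : ℤ) (v : ℤ × ℤ) : ℤ × ℤ := (a * v.1 - b * v.2, b * v.1 + a * v.2)

theorem gaussianMul_injective {a b : ℤ} (h : a ^ 2 + b ^ 2 ≠ 0) :
    Function.Injective (gaussianMul a b) := by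
  rintro ⟨x, y⟩ ⟨z, w⟩ hv
  simp only [gaussianMul, Prod.mk.injEq] at hv ⊢
  constructor <;> apply mul_left_cancel₀ h
  · linear_combination a * hv.1 + b * hv.2
  · linear_combination a * hv.2 - b * hv.1

theorem mem_image_gaussianMul {a b : ℤ} {p : ℕ} (hp : p.Prime) (hab : a ^ 2 + b ^ 2 = p) (m : ℕ)
    (v : ℤ × ℤ) :
    v ∈ gaussianMul a b '' {w : ℤ × ℤ | w.1 ^ 2 + w.2 ^ 2 = (m : ℤ)} ↔
      v.1 ^ 2 + v.2 ^ 2 = ((p * m : ℕ) : ℤ) ∧ (p : ℤ) ∣ a * v.1 + b * v.2 := by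
  have hp0 : (p : ℤ) ≠ 0 := by exact_mod_cast hp.ne_zero
  obtain ⟨x, y⟩ := v
  push_cast
  constructor
  · rintro ⟨⟨u, w⟩, h, hv⟩
    simp only [gaussianMul, Prod.mk.injEq, Set.mem_ofPred_eq] at h hv ⊢
    obtain ⟨rfl, rfl⟩ := hv
    exact ⟨by rw [← h, ← hab]; ring, u, by rw [← hab]; ring⟩
  · rintro ⟨h, u, hu⟩
    have hdvd : (p : ℤ) ∣ a * y - b * x := by
      refine (Nat.prime_iff_prime_int.1 hp).dvd_of_dvd_pow (n := 2) ⟨p * m - p * u ^ 2, ?_⟩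
      linear_combination (p : ℤ) * h - (a * x + b * y + p * u) * hu + (x ^ 2 + y ^ 2) * hab
    obtain ⟨w, hw⟩ := hdvd
    have hx : a * u - b * w = x := by
      apply mul_left_cancel₀ hp0
      linear_combination -a * hu + b * hw + x * hab
    have hy : b * u + a * w = y := by
      apply mul_left_cancel₀ hp0
      linear_combination -b * hu - a * hw + y * hab
    refine ⟨(u, w), ?_, by simp [gaussianMul, hx, hy]⟩
    apply mul_left_cancel₀ hp0
    simp only
    rw [← h, ← hx, ← hy, ← hab]
    ring

theorem ncard_image_gaussianMul {a b : ℤ} {p : ℕ} (hp : p.Prime) (hab : a ^ 2 + b ^ 2 = p)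
    (m : ℕ) :
    (gaussianMul a b '' {w : ℤ × ℤ | w.1 ^ 2 + w.2 ^ 2 = (m : ℤ)}).ncard = r2 m :=
  Set.ncard_image_of_injective _
    (gaussianMul_injective (by rw [hab]; exact_mod_cast hp.ne_zero))

theorem r2_two_mul (m : ℕ) : r2 (2 * m) = r2 m := by
  rw [← ncard_image_gaussianMul (a := 1) (b := 1) Nat.prime_two (by norm_num) m, r2]
  congr 1
  ext v
  rw [mem_image_gaussianMul Nat.prime_two (by norm_num)]
  refine ⟨fun h => ⟨h, ?_⟩, And.left⟩
  have h2 : Even (v.1 ^ 2 + v.2 ^ 2) := by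
    rw [show v.1 ^ 2 + v.2 ^ 2 = _ from h]; exact ⟨m, by push_cast; ring⟩
  have h3 : Even (v.1 + v.2) := by simpa [Int.even_add, Int.even_pow] using h2
  simpa using h3.two_dvd

theorem r2_inert_prime_mul {p m : ℕ} (hp : p.Prime) (hp3 : p % 4 = 3) :
    r2 (p * m) = if p ∣ m then r2 (m / p) else 0 := by
  have hp0 : (p : ℤ) ≠ 0 := by exact_mod_cast hp.ne_zero
  rw [← ncard_image_mul_prime hp, r2]
  congr 1
  ext ⟨x, y⟩
  push_cast
  constructor
  · intro h
    simp only [Set.mem_ofPred_eq] at h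
    have : Fact p.Prime := ⟨hp⟩
    have hy : (p : ℤ) ∣ y := by
      rw [← ZMod.intCast_zmod_eq_zero_iff_dvd]
      by_contra hy
      refine ZMod.mod_four_ne_three_of_sq_eq_neg_sq' (x := (x : ZMod p)) hy ?_ hp3
      rw [eq_neg_iff_add_eq_zero]
      have := congrArg (Int.cast : ℤ → ZMod p) h
      simpa using this
    have hx : (p : ℤ) ∣ x := by
      refine (Nat.prime_iff_prime_int.1 hp).dvd_of_dvd_pow (n := 2) ?_
      rw [← Int.dvd_add_left (dvd_pow hy two_ne_zero), h]
      exact dvd_mul_right _ _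
    obtain ⟨u, rfl⟩ := hx
    obtain ⟨w, rfl⟩ := hy
    refine ⟨(u, w), ?_, rfl⟩
    apply mul_left_cancel₀ hp0
    simp only
    rw [← h]
    ring
  · rintro ⟨⟨u, w⟩, h, hv⟩
    simp only [Prod.mk.injEq, Set.mem_ofPred_eq] at h hv ⊢
    obtain ⟨rfl, rfl⟩ := hv
    rw [← h]
    ring

theorem r2_split_prime_mul {p m : ℕ} (hp : p.Prime) (hp1 : p % 4 = 1) :
    r2 (p * m) + (if p ∣ m then r2 (m / p) else 0) = 2 * r2 m := by
  have hp0 : (p : ℤ) ≠ 0 := by exact_mod_cast hp.ne_zero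
  have hpp := Nat.prime_iff_prime_int.1 hp
  have : Fact p.Prime := ⟨hp⟩
  obtain ⟨a', b', hab'⟩ := Nat.Prime.sq_add_sq (p := p) (by omega)
  obtain ⟨a, b, hab⟩ : ∃ a b : ℤ, a ^ 2 + b ^ 2 = p := ⟨a', b', by exact_mod_cast hab'⟩
  have hab2 : a ^ 2 + (-b) ^ 2 = p := by rw [neg_sq, hab]
  have hndvd : ∀ c d : ℤ, c ^ 2 + d ^ 2 = p → ¬ (p : ℤ) ∣ c := by
    intro c d hcd hc
    have hd : (p : ℤ) ∣ d := by
      refine hpp.dvd_of_dvd_pow (n := 2) ?_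
      rw [← Int.dvd_add_right (dvd_pow hc two_ne_zero), hcd]
    obtain ⟨e, rfl⟩ := hc
    obtain ⟨f, rfl⟩ := hd
    refine hpp.not_isUnit (isUnit_of_dvd_one ⟨e ^ 2 + f ^ 2, ?_⟩)
    apply mul_left_cancel₀ hp0
    linear_combination -hcd
  have hp2 : ¬ (p : ℤ) ∣ 2 := by
    intro h
    have : p ∣ 2 := by exact_mod_cast h
    have := Nat.le_of_dvd two_pos this
    have := hp.two_le
    omega
  set A := gaussianMul a b '' {w : ℤ × ℤ | w.1 ^ 2 + w.2 ^ 2 = (m : ℤ)} with hA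
  set B := gaussianMul a (-b) '' {w : ℤ × ℤ | w.1 ^ 2 + w.2 ^ 2 = (m : ℤ)} with hB
  have hunion : A ∪ B = {v : ℤ × ℤ | v.1 ^ 2 + v.2 ^ 2 = ((p * m : ℕ) : ℤ)} := by
    ext v
    rw [Set.mem_union, hA, hB, mem_image_gaussianMul hp hab, mem_image_gaussianMul hp hab2,
      ← and_or_left, Set.mem_ofPred_eq, and_iff_left_iff_imp]
    intro h
    push_cast at h
    refine hpp.dvd_or_dvd ⟨a ^ 2 * m - v.2 ^ 2, ?_⟩
    linear_combination a ^ 2 * h - v.2 ^ 2 * hab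
  have hinter : A ∩ B = (fun v : ℤ × ℤ => ((p : ℤ) * v.1, (p : ℤ) * v.2)) ''
      {v : ℤ × ℤ | (p : ℤ) * (v.1 ^ 2 + v.2 ^ 2) = m} := by
    ext ⟨x, y⟩
    rw [Set.mem_inter_iff, hA, hB, mem_image_gaussianMul hp hab, mem_image_gaussianMul hp hab2]
    push_cast
    constructor
    · rintro ⟨⟨h, h1⟩, -, h2⟩
      have hx : (p : ℤ) ∣ x := by
        have h3 : (p : ℤ) ∣ 2 * (a * x) := by
          obtain ⟨s, hs⟩ := h1
          obtain ⟨t, ht⟩ := h2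
          exact ⟨s + t, by linear_combination hs + ht⟩
        exact (hpp.dvd_or_dvd ((hpp.dvd_or_dvd h3).resolve_left hp2)).resolve_left
          (hndvd a b hab)
      have hy : (p : ℤ) ∣ y := by
        have h3 : (p : ℤ) ∣ 2 * (b * y) := by
          obtain ⟨s, hs⟩ := h1
          obtain ⟨t, ht⟩ := h2
          exact ⟨s - t, by linear_combination hs - ht⟩
        exact (hpp.dvd_or_dvd ((hpp.dvd_or_dvd h3).resolve_left hp2)).resolve_left
          (hndvd b a (by rw [add_comm, hab]))
      obtain ⟨u, rfl⟩ := hx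
      obtain ⟨w, rfl⟩ := hy
      refine ⟨(u, w), ?_, rfl⟩
      apply mul_left_cancel₀ hp0
      simp only
      rw [← h]
      ring
    · rintro ⟨⟨u, w⟩, h, hv⟩
      simp only [Prod.mk.injEq, Set.mem_ofPred_eq] at h hv ⊢
      obtain ⟨rfl, rfl⟩ := hv
      have hnorm : ((p : ℤ) * u) ^ 2 + (p * w) ^ 2 = p * m := by rw [← h]; ring
      exact ⟨⟨hnorm, a * u + b * w, by ring⟩, hnorm, a * u + -b * w, by ring⟩
  have hcard := Set.ncard_union_add_ncard_inter A B
    ((finite_sq_add_sq_eq m).image _) ((finite_sq_add_sq_eq m).image _)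
  rw [hunion, hinter, ncard_image_mul_prime hp, hA, hB, ncard_image_gaussianMul hp hab,
    ncard_image_gaussianMul hp hab2] at hcard
  rw [two_mul, ← hcard, r2]

theorem r2_prime_mul {p m : ℕ} (hp : p.Prime) :
    (r2 (p * m) : ℤ) + ZMod.χ₄ (p : ZMod 4) * (if p ∣ m then (r2 (m / p) : ℤ) else 0) =
      (1 + ZMod.χ₄ (p : ZMod 4)) * r2 m := by
  rcases hp.eq_two_or_odd with rfl | hodd
  · simp [r2_two_mul]
  · obtain h | h : p % 4 = 1 ∨ p % 4 = 3 := by omega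
    · rw [ZMod.χ₄_nat_one_mod_four h, one_mul]
      exact_mod_cast r2_split_prime_mul hp h
    · rw [ZMod.χ₄_nat_three_mod_four h, r2_inert_prime_mul hp h]
      push_cast
      ring

/-- Gauss–Lagrange: `r₂(n) = 4 (d₁(n) − d₃(n))`, where `dₖ(n)` is the number of positive
divisors of `n` congruent to `k` mod `4`. -/
theorem two_squares_divisors (n : ℕ) (hn : 0 < n) :
    (r2 n : ℤ) =
      4 * (((n.divisors.filter (fun d => d % 4 = 1)).card : ℤ)
            - ((n.divisors.filter (fun d => d % 4 = 3)).card : ℤ)) := by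
  rw [← sum_divisors_chi_four]
  refine eq_of_prime_recurrence (F := fun n => (r2 n : ℤ))
    (G := fun n => 4 * ∑ d ∈ n.divisors, ZMod.χ₄ (d : ZMod 4))
    (fun p => ZMod.χ₄ (p : ZMod 4)) (by simp [r2_one]) (fun p m hp _ => r2_prime_mul hp)
    (fun p m hp hm => ?_) n hn
  have h := sum_divisors_prime_mul (f := fun d => ZMod.χ₄ (d : ZMod 4))
    (fun a b => by rw [Nat.cast_mul, map_mul]) hp hm
  split_ifs at h ⊢ <;> linear_combination 4 * h
end
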